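/- arXiv:1704.05263 — 9 statements merged into one kernel-verified Lean document; each statement's English description precedes it below -/
import Mathlib

section
/- For any two Λ-labeled restriction graphs R1 and R2, the language inclusion L_R(R1) ⊆ L_R(R2) holds if and only if there exists a graph morphism from R1 to R2 (i.e., R1 → R2). -/
/-- A `Λ`-labeled graph: finite sets of nodes and edges, with source/target maps
and an edge labeling. -/
structure LGraph (Λ : Type) : Type 1 where
  V : Type
  E : Type
  finV : Finite V
  finE : Finite E
  src : E → V
  tgt : E → V
  lab : E → Λ

/-- A morphism of `Λ`-labeled graphs: maps on nodes and edges commuting with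
source and target and preserving labels. -/
structure LGraph.Hom {Λ : Type} (G H : LGraph Λ) : Type where
  fV : G.V → H.V
  fE : G.E → H.E
  src_comm : ∀ e, H.src (fE e) = fV (G.src e)
  tgt_comm : ∀ e, H.tgt (fE e) = fV (G.tgt e)
  lab_comm : ∀ e, H.lab (fE e) = G.lab e

/-- Composition of graph morphisms. -/
def LGraph.Hom.comp {Λ : Type} {G H K : LGraph Λ} (ψ : LGraph.Hom H K)
    (φ : LGraph.Hom G H) : LGraph.Hom G K where
  fV := ψ.fV ∘ φ.fV
  fE := ψ.fE ∘ φ.fE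
  src_comm e := by simp [Function.comp_apply, ψ.src_comm, φ.src_comm]
  tgt_comm e := by simp [Function.comp_apply, ψ.tgt_comm, φ.tgt_comm]
  lab_comm e := by simp [Function.comp_apply, ψ.lab_comm, φ.lab_comm]

/-- `G → H`: there exists some graph morphism from `G` to `H`. -/
def LGraph.Arrow {Λ : Type} (G H : LGraph Λ) : Prop := Nonempty (LGraph.Hom G H)

/-- The type graph language `L(T) = {G | G → T}`. -/
def TGLang {Λ : Type} (T : LGraph Λ) : Set (LGraph Λ) := {G | LGraph.Arrow G T}

/-- The restriction graph language `L_R(R) = {G | R ↛ G}`. -/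
def RGLang {Λ : Type} (R : LGraph Λ) : Set (LGraph Λ) := {G | ¬ LGraph.Arrow R G}

/-- Language inclusion for restriction graphs is equivalent to the existence of a
graph morphism: `L_R(R1) ⊆ L_R(R2)` iff `R1 → R2`. -/
theorem restrictionGraphLang_subset_iff {Λ : Type} (R1 R2 : LGraph Λ) :
    RGLang R1 ⊆ RGLang R2 ↔ LGraph.Arrow R1 R2 := by
  constructor
  · intro h
    by_contra hn
    exact h (show R2 ∈ RGLang R1 from hn) ⟨⟨id, id, fun _ => rfl, fun _ => rfl, fun _ => rfl⟩⟩
  · rintro ⟨φ⟩ G hG ⟨ψ⟩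
    exact hG ⟨ψ.comp φ⟩
end

section
/- Let T_0, T_1, …, T_n be Λ-labeled type graphs. Then L(T_0) ⊆ L(T_1) ∪ … ∪ L(T_n) holds if and only if there exists an index k with 1 ≤ k ≤ n and a graph morphism T_0 → T_k. Consequently, the language of the type-graph-logic formula T_0 ∧ ¬T_1 ∧ … ∧ ¬T_n is empty if and only if such a morphism exists. -/
/-- `L(T_0) ⊆ L(T_1) ∪ … ∪ L(T_n)` iff there is some `k` with `1 ≤ k ≤ n` and a
morphism `T_0 → T_k`; consequently the language of the type-graph-logic formula
`T_0 ∧ ¬T_1 ∧ … ∧ ¬T_n`, i.e. `L(T_0) \ (L(T_1) ∪ … ∪ L(T_n))`, is empty iff such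
a morphism exists. (Here `T k.succ` for `k : Fin n` ranges over `T_1, …, T_n`.) -/
theorem typeGraphLogic_emptiness {Λ : Type} (n : ℕ) (T : Fin (n + 1) → LGraph Λ) :
    (TGLang (T 0) ⊆ ⋃ k : Fin n, TGLang (T k.succ) ↔
      ∃ k : Fin n, LGraph.Arrow (T 0) (T k.succ)) ∧
    (TGLang (T 0) \ (⋃ k : Fin n, TGLang (T k.succ)) = ∅ ↔
      ∃ k : Fin n, LGraph.Arrow (T 0) (T k.succ)) := by
  have key : TGLang (T 0) ⊆ ⋃ k : Fin n, TGLang (T k.succ) ↔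
      ∃ k : Fin n, LGraph.Arrow (T 0) (T k.succ) := by
    constructor
    · intro h
      have h0 : T 0 ∈ TGLang (T 0) :=
        ⟨⟨id, id, fun _ => rfl, fun _ => rfl, fun _ => rfl⟩⟩
      exact Set.mem_iUnion.mp (h h0)
    · rintro ⟨k, ⟨ψ⟩⟩ G ⟨φ⟩
      exact Set.mem_iUnion.mpr ⟨k, ⟨ψ.comp φ⟩⟩
  exact ⟨key, Set.diff_eq_empty.trans key⟩
end

section
/- Let S be a Λ-labeled restriction graph and let ρ = (L ←φ_L– I –φ_R→ R) be a DPO rule. Then the restriction graph language L_R(S) is closed under rewriting via ρ if and only if the following condition holds: for every graph F, every pair of jointly surjective morphisms α : R → F and β : S → F, and every graph E obtained by applying ρ backwards to F with comatch α, there exists a morphism S → E (i.e., E ∉ L_R(S)). -/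
/-- `(f, g, h, k)` is a pushout square: `h ∘ f = k ∘ g` and the universal property. -/
structure IsPushout {Λ : Type} {A B C D : LGraph Λ}
    (f : LGraph.Hom A B) (g : LGraph.Hom A C)
    (h : LGraph.Hom B D) (k : LGraph.Hom C D) : Prop where
  comm : h.comp f = k.comp g
  universal : ∀ (X : LGraph Λ) (h' : LGraph.Hom B X) (k' : LGraph.Hom C X),
      h'.comp f = k'.comp g → ∃! u : LGraph.Hom D X, u.comp h = h' ∧ u.comp k = k'

/-- `G ⇒_ρ H` for the DPO rule `ρ = (L ←φL– I –φR→ R)`: there are a graph `C` and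
morphisms forming the two pushout squares of a DPO diagram. -/
def Rewrites {Λ : Type} {L I R : LGraph Λ}
    (φL : LGraph.Hom I L) (φR : LGraph.Hom I R) (G H : LGraph Λ) : Prop :=
  ∃ (C : LGraph Λ) (m : LGraph.Hom L G) (n : LGraph.Hom I C)
    (m' : LGraph.Hom R H) (c1 : LGraph.Hom C G) (c2 : LGraph.Hom C H),
    IsPushout φL n m c1 ∧ IsPushout φR n m' c2

/-- `α` and `β` are jointly surjective: every node and edge of `F` lies in the
image of `α` or of `β`. -/
def JointlySurjective {Λ : Type} {R S F : LGraph Λ}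
    (α : LGraph.Hom R F) (β : LGraph.Hom S F) : Prop :=
  (∀ v : F.V, (∃ x, α.fV x = v) ∨ (∃ y, β.fV y = v)) ∧
  (∀ e : F.E, (∃ x, α.fE x = e) ∨ (∃ y, β.fE y = e))

/-- `E` is obtained by applying the rule `ρ = (L ←φL– I –φR→ R)` backwards to `F`
with comatch `α`: `E ⇒_ρ F` with the morphism `R → F` of the right pushout equal to `α`. -/
def BackApply {Λ : Type} {L I R : LGraph Λ}
    (φL : LGraph.Hom I L) (φR : LGraph.Hom I R)
    (F : LGraph Λ) (α : LGraph.Hom R F) (E : LGraph Λ) : Prop :=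
  ∃ (C : LGraph Λ) (m : LGraph.Hom L E) (n : LGraph.Hom I C)
    (c1 : LGraph.Hom C E) (c2 : LGraph.Hom C F),
    IsPushout φL n m c1 ∧ IsPushout φR n α c2


namespace DPOAux

variable {Λ : Type}

theorem hom_ext {G H : LGraph Λ} {f g : LGraph.Hom G H} (hV : ∀ v, f.fV v = g.fV v)
    (hE : ∀ e, f.fE e = g.fE e) : f = g := by
  cases f; cases g
  simp only [LGraph.Hom.mk.injEq]
  exact ⟨funext hV, funext hE⟩

theorem comp_V {A B B' D : LGraph Λ} {f : LGraph.Hom A B} {g : LGraph.Hom A B'}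
    {h : LGraph.Hom B D} {k : LGraph.Hom B' D} (H : h.comp f = k.comp g) (v : A.V) :
    h.fV (f.fV v) = k.fV (g.fV v) :=
  congrFun (congrArg LGraph.Hom.fV H) v

theorem comp_E {A B B' D : LGraph Λ} {f : LGraph.Hom A B} {g : LGraph.Hom A B'}
    {h : LGraph.Hom B D} {k : LGraph.Hom B' D} (H : h.comp f = k.comp g) (v : A.E) :
    h.fE (f.fE v) = k.fE (g.fE v) :=
  congrFun (congrArg LGraph.Hom.fE H) v

theorem app_V {A B D : LGraph Λ} {f : LGraph.Hom A B}
    {h : LGraph.Hom B D} {k : LGraph.Hom A D} (H : h.comp f = k) (v : A.V) :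
    h.fV (f.fV v) = k.fV v :=
  congrFun (congrArg LGraph.Hom.fV H) v

theorem app_E {A B D : LGraph Λ} {f : LGraph.Hom A B}
    {h : LGraph.Hom B D} {k : LGraph.Hom A D} (H : h.comp f = k) (v : A.E) :
    h.fE (f.fE v) = k.fE v :=
  congrFun (congrArg LGraph.Hom.fE H) v

/-- Identity morphism. -/
def idHom (G : LGraph Λ) : LGraph.Hom G G := ⟨id, id, fun _ => rfl, fun _ => rfl, fun _ => rfl⟩

/-- The subgraph cut out by predicates on nodes and edges. -/
def sub (H : LGraph Λ) (PV : H.V → Prop) (PE : H.E → Prop)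
    (hs : ∀ e, PE e → PV (H.src e)) (ht : ∀ e, PE e → PV (H.tgt e)) : LGraph Λ where
  V := {v // PV v}
  E := {e // PE e}
  finV := by have := H.finV; infer_instance
  finE := by have := H.finE; infer_instance
  src e := ⟨H.src e.1, hs e.1 e.2⟩
  tgt e := ⟨H.tgt e.1, ht e.1 e.2⟩
  lab e := H.lab e.1

/-- Inclusion of a subgraph. -/
def incl (H : LGraph Λ) (PV : H.V → Prop) (PE : H.E → Prop)
    (hs : ∀ e, PE e → PV (H.src e)) (ht : ∀ e, PE e → PV (H.tgt e)) :
    LGraph.Hom (sub H PV PE hs ht) H :=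
  ⟨Subtype.val, Subtype.val, fun _ => rfl, fun _ => rfl, fun _ => rfl⟩

/-- Factor a morphism through a subgraph. -/
def lift {G H : LGraph Λ} (f : LGraph.Hom G H) (PV : H.V → Prop) (PE : H.E → Prop)
    (hs : ∀ e, PE e → PV (H.src e)) (ht : ∀ e, PE e → PV (H.tgt e))
    (hV : ∀ v, PV (f.fV v)) (hE : ∀ e, PE (f.fE e)) :
    LGraph.Hom G (sub H PV PE hs ht) where
  fV v := ⟨f.fV v, hV v⟩
  fE e := ⟨f.fE e, hE e⟩
  src_comm e := Subtype.ext (f.src_comm e)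
  tgt_comm e := Subtype.ext (f.tgt_comm e)
  lab_comm e := f.lab_comm e

/-- Canonical pushout object. -/
def po {A B C : LGraph Λ} (f : LGraph.Hom A B) (g : LGraph.Hom A C) : LGraph Λ where
  V := Quot (fun x y : B.V ⊕ C.V => ∃ a, x = Sum.inl (f.fV a) ∧ y = Sum.inr (g.fV a))
  E := Quot (fun x y : B.E ⊕ C.E => ∃ a, x = Sum.inl (f.fE a) ∧ y = Sum.inr (g.fE a))
  finV := by have := B.finV; have := C.finV; infer_instance
  finE := by have := B.finE; have := C.finE; infer_instance
  src := Quot.lift (fun x => Quot.mk _ (Sum.map B.src C.src x)) (by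
    rintro _ _ ⟨a, rfl, rfl⟩
    exact Quot.sound ⟨A.src a, by simp [f.src_comm], by simp [g.src_comm]⟩)
  tgt := Quot.lift (fun x => Quot.mk _ (Sum.map B.tgt C.tgt x)) (by
    rintro _ _ ⟨a, rfl, rfl⟩
    exact Quot.sound ⟨A.tgt a, by simp [f.tgt_comm], by simp [g.tgt_comm]⟩)
  lab := Quot.lift (Sum.elim B.lab C.lab) (by
    rintro _ _ ⟨a, rfl, rfl⟩
    simp [f.lab_comm, g.lab_comm])

/-- Left coprojection. -/
def poL {A B C : LGraph Λ} (f : LGraph.Hom A B) (g : LGraph.Hom A C) :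
    LGraph.Hom B (po f g) :=
  ⟨fun v => Quot.mk _ (Sum.inl v), fun v => Quot.mk _ (Sum.inl v),
    fun _ => rfl, fun _ => rfl, fun _ => rfl⟩

/-- Right coprojection. -/
def poR {A B C : LGraph Λ} (f : LGraph.Hom A B) (g : LGraph.Hom A C) :
    LGraph.Hom C (po f g) :=
  ⟨fun v => Quot.mk _ (Sum.inr v), fun v => Quot.mk _ (Sum.inr v),
    fun _ => rfl, fun _ => rfl, fun _ => rfl⟩

/-- Mediating morphism out of the canonical pushout. -/
def poDesc {A B C X : LGraph Λ} (f : LGraph.Hom A B) (g : LGraph.Hom A C)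
    (h : LGraph.Hom B X) (k : LGraph.Hom C X) (H : h.comp f = k.comp g) :
    LGraph.Hom (po f g) X where
  fV := Quot.lift (Sum.elim h.fV k.fV) (by
    rintro _ _ ⟨a, rfl, rfl⟩
    exact comp_V H a)
  fE := Quot.lift (Sum.elim h.fE k.fE) (by
    rintro _ _ ⟨a, rfl, rfl⟩
    exact comp_E H a)
  src_comm := by
    rintro ⟨e | e⟩
    · exact h.src_comm e
    · exact k.src_comm e
  tgt_comm := by
    rintro ⟨e | e⟩
    · exact h.tgt_comm e
    · exact k.tgt_comm e
  lab_comm := by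
    rintro ⟨e | e⟩
    · exact h.lab_comm e
    · exact k.lab_comm e

theorem po_isPushout {A B C : LGraph Λ} (f : LGraph.Hom A B) (g : LGraph.Hom A C) :
    IsPushout f g (poL f g) (poR f g) where
  comm := hom_ext (fun v => Quot.sound ⟨v, rfl, rfl⟩) (fun v => Quot.sound ⟨v, rfl, rfl⟩)
  universal X h k H := by
    refine ⟨poDesc f g h k H, ⟨rfl, rfl⟩, ?_⟩
    rintro u ⟨h1, h2⟩
    refine hom_ext ?_ ?_
    · rintro ⟨v | v⟩
      · exact app_V h1 v
      · exact app_V h2 v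
    · rintro ⟨v | v⟩
      · exact app_E h1 v
      · exact app_E h2 v

/-- The two morphisms into a pushout are jointly surjective. -/
theorem jointlySurjective_of_isPushout {A B C D : LGraph Λ} {f : LGraph.Hom A B}
    {g : LGraph.Hom A C} {h : LGraph.Hom B D} {k : LGraph.Hom C D}
    (P : IsPushout f g h k) : JointlySurjective h k := by
  obtain ⟨u, ⟨hu1, hu2⟩, -⟩ := P.universal _ _ _ (po_isPushout f g).comm
  have key : (poDesc f g h k P.comm).comp u = idHom D := by
    obtain ⟨w, -, hw⟩ := P.universal _ _ _ P.comm
    rw [hw ((poDesc f g h k P.comm).comp u), hw (idHom D) ⟨rfl, rfl⟩]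
    constructor
    · exact hom_ext (fun v => congrArg (poDesc f g h k P.comm).fV (app_V hu1 v))
        (fun v => congrArg (poDesc f g h k P.comm).fE (app_E hu1 v))
    · exact hom_ext (fun v => congrArg (poDesc f g h k P.comm).fV (app_V hu2 v))
        (fun v => congrArg (poDesc f g h k P.comm).fE (app_E hu2 v))
  constructor
  · intro v
    have hv := app_V key v
    rcases hq : u.fV v with ⟨x | x⟩
    · rw [hq] at hv; exact Or.inl ⟨x, hv⟩
    · rw [hq] at hv; exact Or.inr ⟨x, hv⟩
  · intro v
    have hv := app_E key v
    rcases hq : u.fE v with ⟨x | x⟩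
    · rw [hq] at hv; exact Or.inl ⟨x, hv⟩
    · rw [hq] at hv; exact Or.inr ⟨x, hv⟩

/-- `X` with one extra node and, for every pair of nodes, an extra edge for every `j : J`. -/
def ext (X : LGraph Λ) (J : LGraph Λ) : LGraph Λ where
  V := Option X.V
  E := X.E ⊕ (Option X.V × Option X.V × J.E)
  finV := by have := X.finV; infer_instance
  finE := by have := X.finV; have := X.finE; have := J.finE; infer_instance
  src := Sum.elim (fun e => some (X.src e)) (fun t => t.1)
  tgt := Sum.elim (fun e => some (X.tgt e)) (fun t => t.2.1)
  lab := Sum.elim X.lab (fun t => J.lab t.2.2)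

/-- The inclusion of `X` into its extension. -/
def toExt (X J : LGraph Λ) : LGraph.Hom X (ext X J) :=
  ⟨some, Sum.inl, fun _ => rfl, fun _ => rfl, fun _ => rfl⟩

open Classical in
/-- Extend a morphism defined on a subgraph of `C`. -/
noncomputable def extend {C X : LGraph Λ} (PV : C.V → Prop) (PE : C.E → Prop)
    (hs : ∀ e, PE e → PV (C.src e)) (ht : ∀ e, PE e → PV (C.tgt e))
    (k : LGraph.Hom (sub C PV PE hs ht) X) : LGraph.Hom C (ext X C) :=
  let q : C.V → Option X.V := fun v => if h : PV v then some (k.fV ⟨v, h⟩) else none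
  { fV := q
    fE := fun e => if h : PE e then Sum.inl (k.fE ⟨e, h⟩)
      else Sum.inr (q (C.src e), q (C.tgt e), e)
    src_comm := fun e => by
      by_cases h : PE e
      · have := k.src_comm ⟨e, h⟩
        have hq : q (C.src e) = some (k.fV ⟨C.src e, hs e h⟩) := dif_pos (hs e h)
        exact (congrArg (ext X C).src (dif_pos h)).trans ((congrArg some this).trans hq.symm)
      · exact congrArg (ext X C).src (dif_neg h)
    tgt_comm := fun e => by
      by_cases h : PE e
      · have := k.tgt_comm ⟨e, h⟩
        have hq : q (C.tgt e) = some (k.fV ⟨C.tgt e, ht e h⟩) := dif_pos (ht e h)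
        exact (congrArg (ext X C).tgt (dif_pos h)).trans ((congrArg some this).trans hq.symm)
      · exact congrArg (ext X C).tgt (dif_neg h)
    lab_comm := fun e => by
      by_cases h : PE e
      · have := k.lab_comm ⟨e, h⟩
        exact (congrArg (ext X C).lab (dif_pos h)).trans this
      · exact congrArg (ext X C).lab (dif_neg h) }

theorem extend_V {C X : LGraph Λ} (PV : C.V → Prop) (PE : C.E → Prop)
    (hs : ∀ e, PE e → PV (C.src e)) (ht : ∀ e, PE e → PV (C.tgt e))
    (k : LGraph.Hom (sub C PV PE hs ht) X) (v : C.V) (h : PV v) :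
    (extend PV PE hs ht k).fV v = some (k.fV ⟨v, h⟩) :=
  dif_pos h

theorem extend_E {C X : LGraph Λ} (PV : C.V → Prop) (PE : C.E → Prop)
    (hs : ∀ e, PE e → PV (C.src e)) (ht : ∀ e, PE e → PV (C.tgt e))
    (k : LGraph.Hom (sub C PV PE hs ht) X) (v : C.E) (h : PE v) :
    (extend PV PE hs ht k).fE v = Sum.inl (k.fE ⟨v, h⟩) :=
  dif_pos h

/-- Pushouts restrict to subgraphs of the pushout object containing the image of `B`. -/
theorem restrict_pushout {A B C D : LGraph Λ} {f : LGraph.Hom A B}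
    {g : LGraph.Hom A C} {h : LGraph.Hom B D} {k : LGraph.Hom C D}
    (P : IsPushout f g h k) (PV : D.V → Prop) (PE : D.E → Prop)
    (hs : ∀ e, PE e → PV (D.src e)) (ht : ∀ e, PE e → PV (D.tgt e))
    (hV : ∀ v, PV (h.fV v)) (hE : ∀ e, PE (h.fE e)) :
    ∃ (C' : LGraph Λ) (g' : LGraph.Hom A C') (i : LGraph.Hom C' C)
      (k' : LGraph.Hom C' (sub D PV PE hs ht)),
      i.comp g' = g ∧ IsPushout f g' (lift h PV PE hs ht hV hE) k' := by
  have hs' : ∀ e, PE (k.fE e) → PV (k.fV (C.src e)) := fun e he => by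
    rw [← k.src_comm]; exact hs _ he
  have ht' : ∀ e, PE (k.fE e) → PV (k.fV (C.tgt e)) := fun e he => by
    rw [← k.tgt_comm]; exact ht _ he
  have gV : ∀ a, PV (k.fV (g.fV a)) := fun a => by
    rw [← comp_V P.comm]; exact hV _
  have gE : ∀ a, PE (k.fE (g.fE a)) := fun a => by
    rw [← comp_E P.comm]; exact hE _
  let C' := sub C (fun v => PV (k.fV v)) (fun e => PE (k.fE e)) hs' ht'
  let g' : LGraph.Hom A C' := lift g _ _ hs' ht' gV gE
  let i : LGraph.Hom C' C := incl C _ _ hs' ht'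
  let k' : LGraph.Hom C' (sub D PV PE hs ht) :=
    lift (k.comp i) PV PE hs ht (fun v => v.2) (fun e => e.2)
  refine ⟨C', g', i, k', rfl, ?_, ?_⟩
  · exact hom_ext (fun v => Subtype.ext (comp_V P.comm v))
      (fun v => Subtype.ext (comp_E P.comm v))
  intro X b c hbc
  obtain ⟨JV, JE⟩ := jointlySurjective_of_isPushout P
  obtain ⟨u, ⟨hu1, hu2⟩, -⟩ := P.universal (ext X C) ((toExt X C).comp b)
    (extend _ _ hs' ht' c) (hom_ext
      (fun v => by
        refine Eq.trans ?_ (extend_V _ _ hs' ht' c (g.fV v) (gV v)).symm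
        exact congrArg some (comp_V hbc v))
      (fun v => by
        refine Eq.trans ?_ (extend_E _ _ hs' ht' c (g.fE v) (gE v)).symm
        exact congrArg Sum.inl (comp_E hbc v)))
  have uV1 : ∀ x, u.fV (h.fV x) = some (b.fV x) := fun x => app_V hu1 x
  have uE1 : ∀ x, u.fE (h.fE x) = Sum.inl (b.fE x) := fun x => app_E hu1 x
  have uV2 : ∀ x : C'.V, u.fV (k.fV x.1) = some (c.fV x) := fun x =>
    (app_V hu2 x.1).trans (extend_V _ _ hs' ht' c x.1 x.2)
  have uE2 : ∀ x : C'.E, u.fE (k.fE x.1) = Sum.inl (c.fE x) := fun x =>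
    (app_E hu2 x.1).trans (extend_E _ _ hs' ht' c x.1 x.2)
  have exV : ∀ v : {v // PV v}, ∃ y : X.V, u.fV v.1 = some y := by
    rintro ⟨v, hv⟩
    rcases JV v with ⟨x, rfl⟩ | ⟨x, rfl⟩
    · exact ⟨_, uV1 x⟩
    · exact ⟨_, uV2 ⟨x, hv⟩⟩
  have exE : ∀ v : {v // PE v}, ∃ y : X.E, u.fE v.1 = Sum.inl y := by
    rintro ⟨v, hv⟩
    rcases JE v with ⟨x, rfl⟩ | ⟨x, rfl⟩
    · exact ⟨_, uE1 x⟩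
    · exact ⟨_, uE2 ⟨x, hv⟩⟩
  choose wV hwV using exV
  choose wE hwE using exE
  let w : LGraph.Hom (sub D PV PE hs ht) X :=
    { fV := wV
      fE := wE
      src_comm := fun e => by
        have h1 := u.src_comm e.1
        rw [hwE e] at h1
        exact Option.some_injective _ (h1.trans (hwV ⟨D.src e.1, hs e.1 e.2⟩))
      tgt_comm := fun e => by
        have h1 := u.tgt_comm e.1
        rw [hwE e] at h1
        exact Option.some_injective _ (h1.trans (hwV ⟨D.tgt e.1, ht e.1 e.2⟩))
      lab_comm := fun e => by
        have h1 := u.lab_comm e.1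
        rw [hwE e] at h1
        exact h1 }
  refine ⟨w, ⟨hom_ext ?_ ?_, hom_ext ?_ ?_⟩, ?_⟩
  · exact fun v => Option.some_injective _ ((hwV ⟨h.fV v, hV v⟩).symm.trans (uV1 v))
  · exact fun v => Sum.inl_injective ((hwE ⟨h.fE v, hE v⟩).symm.trans (uE1 v))
  · exact fun v => Option.some_injective _ ((hwV ⟨k.fV v.1, v.2⟩).symm.trans (uV2 v))
  · exact fun v => Sum.inl_injective ((hwE ⟨k.fE v.1, v.2⟩).symm.trans (uE2 v))
  rintro z ⟨hz1, hz2⟩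
  refine hom_ext ?_ ?_
  · rintro ⟨v, hv⟩
    rcases JV v with ⟨x, rfl⟩ | ⟨x, rfl⟩
    · exact (app_V hz1 x).trans (Option.some_injective _ ((uV1 x).symm.trans (hwV ⟨_, hv⟩)))
    · exact (app_V hz2 ⟨x, hv⟩).trans
        (Option.some_injective _ ((uV2 ⟨x, hv⟩).symm.trans (hwV ⟨_, hv⟩)))
  · rintro ⟨v, hv⟩
    rcases JE v with ⟨x, rfl⟩ | ⟨x, rfl⟩
    · exact (app_E hz1 x).trans (Sum.inl_injective ((uE1 x).symm.trans (hwE ⟨_, hv⟩)))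
    · exact (app_E hz2 ⟨x, hv⟩).trans
        (Sum.inl_injective ((uE2 ⟨x, hv⟩).symm.trans (hwE ⟨_, hv⟩)))

end DPOAux

/-- Closure of a restriction graph language under DPO rewriting: `L_R(S)` is closed
under the rule `ρ` iff for all jointly surjective `α : R → F`, `β : S → F` and every
graph `E` obtained by applying `ρ` backwards to `F` with comatch `α`, there is a
morphism `S → E` (i.e. `E ∉ L_R(S)`). -/
theorem restrictionGraphLang_closed_under_dpo_iff {Λ : Type} (S : LGraph Λ)
    {L I R : LGraph Λ} (φL : LGraph.Hom I L) (φR : LGraph.Hom I R) :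
    (∀ G H : LGraph Λ, G ∈ RGLang S → Rewrites φL φR G H → H ∈ RGLang S) ↔
    (∀ (F : LGraph Λ) (α : LGraph.Hom R F) (β : LGraph.Hom S F),
      JointlySurjective α β →
      ∀ E : LGraph Λ, BackApply φL φR F α E → LGraph.Arrow S E) := by
  constructor
  · intro hcl F α β _ E hE
    by_contra hSE
    obtain ⟨C, m, n, c1, c2, h1, h2⟩ := hE
    exact hcl E F hSE ⟨C, m, n, α, c1, c2, h1, h2⟩ ⟨β⟩
  · rintro hc G H hG ⟨C, m, n, m', c1, c2, h1, h2⟩ ⟨β⟩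
    let PV : H.V → Prop := fun v => (∃ x, m'.fV x = v) ∨ (∃ y, β.fV y = v)
    let PE : H.E → Prop := fun e => (∃ x, m'.fE x = e) ∨ (∃ y, β.fE y = e)
    have hs : ∀ e, PE e → PV (H.src e) := by
      rintro _ (⟨x, rfl⟩ | ⟨x, rfl⟩)
      · exact Or.inl ⟨_, (m'.src_comm x).symm⟩
      · exact Or.inr ⟨_, (β.src_comm x).symm⟩
    have ht : ∀ e, PE e → PV (H.tgt e) := by
      rintro _ (⟨x, rfl⟩ | ⟨x, rfl⟩)
      · exact Or.inl ⟨_, (m'.tgt_comm x).symm⟩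
      · exact Or.inr ⟨_, (β.tgt_comm x).symm⟩
    obtain ⟨C', n', i, c2', hi, hP⟩ := DPOAux.restrict_pushout h2 PV PE hs ht
      (fun v => Or.inl ⟨v, rfl⟩) (fun v => Or.inl ⟨v, rfl⟩)
    have hcond := hc _ _ (DPOAux.lift β PV PE hs ht
      (fun v => Or.inr ⟨v, rfl⟩) (fun v => Or.inr ⟨v, rfl⟩)) (by
        constructor
        · rintro ⟨_, ⟨x, rfl⟩ | ⟨x, rfl⟩⟩
          · exact Or.inl ⟨x, rfl⟩
          · exact Or.inr ⟨x, rfl⟩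
        · rintro ⟨_, ⟨x, rfl⟩ | ⟨x, rfl⟩⟩
          · exact Or.inl ⟨x, rfl⟩
          · exact Or.inr ⟨x, rfl⟩)
      (DPOAux.po φL n') ⟨C', _, n', _, c2', DPOAux.po_isPushout φL n', hP⟩
    obtain ⟨s⟩ := hcond
    have hcomm : m.comp φL = (c1.comp i).comp n' := by
      rw [h1.comm, ← hi]; rfl
    exact hG ⟨(DPOAux.poDesc φL n' m (c1.comp i) hcomm).comp s⟩
end

section
/- Let T be a Λ-labeled type graph, let C be a core of T, and let ρ = (L ←φ_L– I –φ_R→ R) be a DPO rule. Then the type graph language L(T) is closed under rewriting via ρ if and only if for every graph morphism t_L : L → C there exists a graph morphism t_R : R → C such that t_L ∘ φ_L = t_R ∘ φ_R. -/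
/-- `H` is a retract of `G`: `H` is (isomorphic to) a subgraph of `G`, witnessed by
an injective morphism, and there is a morphism `G → H`. -/
def IsRetractOf {Λ : Type} (H G : LGraph Λ) : Prop :=
  ∃ i : LGraph.Hom H G, Function.Injective i.fV ∧ Function.Injective i.fE ∧
    Nonempty (LGraph.Hom G H)

/-- `H` is a proper retract of `G`: a retract whose subgraph embedding is not all of `G`. -/
def IsProperRetractOf {Λ : Type} (H G : LGraph Λ) : Prop :=
  ∃ i : LGraph.Hom H G, Function.Injective i.fV ∧ Function.Injective i.fE ∧
    ¬ (Function.Surjective i.fV ∧ Function.Surjective i.fE) ∧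
    Nonempty (LGraph.Hom G H)

/-- `C` is a core of `G`: a retract of `G` having no proper retracts itself. -/
def IsCoreOf {Λ : Type} (C G : LGraph Λ) : Prop :=
  IsRetractOf C G ∧ ∀ H : LGraph Λ, ¬ IsProperRetractOf H C

theorem LGraph.Hom.ext' {Λ : Type} {G H : LGraph Λ} {f g : LGraph.Hom G H}
    (hV : ∀ v, f.fV v = g.fV v) (hE : ∀ e, f.fE e = g.fE e) : f = g := by
  cases f; cases g
  simp only [LGraph.Hom.mk.injEq]
  exact ⟨funext hV, funext hE⟩

theorem LGraph.Hom.comp_assoc' {Λ : Type} {A B C D : LGraph Λ} (h : LGraph.Hom C D)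
    (g : LGraph.Hom B C) (f : LGraph.Hom A B) : (h.comp g).comp f = h.comp (g.comp f) := rfl

/-- The identity morphism. -/
def LGraph.Hom.idHom {Λ : Type} (G : LGraph Λ) : LGraph.Hom G G where
  fV := fun v => v
  fE := fun e => e
  src_comm _ := rfl
  tgt_comm _ := rfl
  lab_comm _ := rfl

/-- Gluing relation on a disjoint union. -/
inductive GlueRel {A B C : Type} (f : A → B) (g : A → C) : B ⊕ C → B ⊕ C → Prop
  | glue (a : A) : GlueRel f g (Sum.inl (f a)) (Sum.inr (g a))

/-- The pushout graph. -/
def pushoutGraph {Λ : Type} {A B C : LGraph Λ} (f : LGraph.Hom A B) (g : LGraph.Hom A C) :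
    LGraph Λ where
  V := Quot (GlueRel f.fV g.fV)
  E := Quot (GlueRel f.fE g.fE)
  finV := by
    haveI := B.finV
    haveI := C.finV
    exact Finite.of_surjective (Quot.mk _) Quot.mk_surjective
  finE := by
    haveI := B.finE
    haveI := C.finE
    exact Finite.of_surjective (Quot.mk _) Quot.mk_surjective
  src := Quot.lift (fun x => Quot.mk _ (Sum.map B.src C.src x)) (by
    rintro _ _ ⟨a⟩
    simp only [Sum.map_inl, Sum.map_inr, f.src_comm, g.src_comm]
    exact Quot.sound (GlueRel.glue _))
  tgt := Quot.lift (fun x => Quot.mk _ (Sum.map B.tgt C.tgt x)) (by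
    rintro _ _ ⟨a⟩
    simp only [Sum.map_inl, Sum.map_inr, f.tgt_comm, g.tgt_comm]
    exact Quot.sound (GlueRel.glue _))
  lab := Quot.lift (Sum.elim B.lab C.lab) (by
    rintro _ _ ⟨a⟩
    simp only [Sum.elim_inl, Sum.elim_inr, f.lab_comm, g.lab_comm])

/-- Left injection into the pushout. -/
def pushoutInl {Λ : Type} {A B C : LGraph Λ} (f : LGraph.Hom A B) (g : LGraph.Hom A C) :
    LGraph.Hom B (pushoutGraph f g) where
  fV v := Quot.mk _ (Sum.inl v)
  fE e := Quot.mk _ (Sum.inl e)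
  src_comm _ := rfl
  tgt_comm _ := rfl
  lab_comm _ := rfl

/-- Right injection into the pushout. -/
def pushoutInr {Λ : Type} {A B C : LGraph Λ} (f : LGraph.Hom A B) (g : LGraph.Hom A C) :
    LGraph.Hom C (pushoutGraph f g) where
  fV v := Quot.mk _ (Sum.inr v)
  fE e := Quot.mk _ (Sum.inr e)
  src_comm _ := rfl
  tgt_comm _ := rfl
  lab_comm _ := rfl

/-- The mediating morphism out of the pushout. -/
def pushoutDesc {Λ : Type} {A B C X : LGraph Λ} (f : LGraph.Hom A B) (g : LGraph.Hom A C)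
    (h : LGraph.Hom B X) (k : LGraph.Hom C X) (w : h.comp f = k.comp g) :
    LGraph.Hom (pushoutGraph f g) X where
  fV := Quot.lift (Sum.elim h.fV k.fV) (by
    rintro _ _ ⟨a⟩
    exact congrFun (congrArg LGraph.Hom.fV w) a)
  fE := Quot.lift (Sum.elim h.fE k.fE) (by
    rintro _ _ ⟨a⟩
    exact congrFun (congrArg LGraph.Hom.fE w) a)
  src_comm := by
    rintro ⟨e | e⟩
    · exact h.src_comm e
    · exact k.src_comm e
  tgt_comm := by
    rintro ⟨e | e⟩
    · exact h.tgt_comm e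
    · exact k.tgt_comm e
  lab_comm := by
    rintro ⟨e | e⟩
    · exact h.lab_comm e
    · exact k.lab_comm e

theorem pushout_isPushout {Λ : Type} {A B C : LGraph Λ} (f : LGraph.Hom A B)
    (g : LGraph.Hom A C) : IsPushout f g (pushoutInl f g) (pushoutInr f g) where
  comm := LGraph.Hom.ext' (fun v => Quot.sound (GlueRel.glue v))
    (fun e => Quot.sound (GlueRel.glue e))
  universal X h k w := by
    refine ⟨pushoutDesc f g h k w, ⟨rfl, rfl⟩, ?_⟩
    rintro u ⟨rfl, rfl⟩
    refine LGraph.Hom.ext' ?_ ?_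
    · rintro ⟨v | v⟩ <;> rfl
    · rintro ⟨v | v⟩ <;> rfl

/-- The image of a morphism. -/
def imageGraph {Λ : Type} {G H : LGraph Λ} (a : LGraph.Hom G H) : LGraph Λ where
  V := Set.range a.fV
  E := Set.range a.fE
  finV := by
    haveI := H.finV
    infer_instance
  finE := by
    haveI := H.finE
    infer_instance
  src e := ⟨H.src e.1, by
    obtain ⟨_, x, rfl⟩ := e
    exact ⟨_, (a.src_comm x).symm⟩⟩
  tgt e := ⟨H.tgt e.1, by
    obtain ⟨_, x, rfl⟩ := e
    exact ⟨_, (a.tgt_comm x).symm⟩⟩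
  lab e := H.lab e.1

/-- Endomorphisms of graphs without proper retracts are invertible. -/
theorem exists_left_inverse {Λ : Type} {C : LGraph Λ}
    (hC : ∀ H : LGraph Λ, ¬ IsProperRetractOf H C) (a : LGraph.Hom C C) :
    ∃ b : LGraph.Hom C C, b.comp a = LGraph.Hom.idHom C := by
  have hs : Function.Surjective a.fV ∧ Function.Surjective a.fE := by
    by_contra hn
    refine hC (imageGraph a) ⟨⟨Subtype.val, Subtype.val, fun _ => rfl, fun _ => rfl,
      fun _ => rfl⟩, Subtype.val_injective, Subtype.val_injective, ?_,
      ⟨⟨fun v => ⟨a.fV v, v, rfl⟩, fun e => ⟨a.fE e, e, rfl⟩, fun e => Subtype.ext (a.src_comm e),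
        fun e => Subtype.ext (a.tgt_comm e), a.lab_comm⟩⟩⟩
    rintro ⟨h1, h2⟩
    refine hn ⟨fun v => ?_, fun e => ?_⟩
    · obtain ⟨⟨_, x, rfl⟩, rfl⟩ := h1 v
      exact ⟨x, rfl⟩
    · obtain ⟨⟨_, x, rfl⟩, rfl⟩ := h2 e
      exact ⟨x, rfl⟩
  haveI := C.finV
  haveI := C.finE
  have iV : Function.Injective a.fV := Finite.injective_iff_surjective.mpr hs.1
  have iE : Function.Injective a.fE := Finite.injective_iff_surjective.mpr hs.2
  have rV := Function.rightInverse_surjInv hs.1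
  have rE := Function.rightInverse_surjInv hs.2
  refine ⟨⟨Function.surjInv hs.1, Function.surjInv hs.2, fun e => iV ?_, fun e => iV ?_,
    fun e => ?_⟩, LGraph.Hom.ext' (fun v => iV (rV _)) (fun e => iE (rE _))⟩
  · rw [← a.src_comm, rE, rV]
  · rw [← a.tgt_comm, rE, rV]
  · rw [← a.lab_comm, rE]

/-- Closure of a type graph language under DPO rewriting: `L(T)` is closed under the
rule `ρ = (L ←φL– I –φR→ R)` iff every morphism `t_L : L → core(T)` extends to a
morphism `t_R : R → core(T)` with `t_L ∘ φ_L = t_R ∘ φ_R`. -/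
theorem typeGraphLang_closed_under_dpo_iff {Λ : Type} (T C : LGraph Λ)
    (hC : IsCoreOf C T) {L I R : LGraph Λ}
    (φL : LGraph.Hom I L) (φR : LGraph.Hom I R) :
    (∀ G H : LGraph Λ, G ∈ TGLang T → Rewrites φL φR G H → H ∈ TGLang T) ↔
    (∀ tL : LGraph.Hom L C, ∃ tR : LGraph.Hom R C, tL.comp φL = tR.comp φR) := by
  obtain ⟨⟨i, -, -, ⟨r⟩⟩, hcore⟩ := hC
  constructor
  · intro hcl tL
    have w : tL.comp φL = (LGraph.Hom.idHom C).comp (tL.comp φL) := rfl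
    obtain ⟨h⟩ := hcl (pushoutGraph φL (tL.comp φL)) (pushoutGraph φR (tL.comp φL))
      ⟨i.comp (pushoutDesc φL (tL.comp φL) tL (LGraph.Hom.idHom C) w)⟩
      ⟨C, _, _, _, _, _, pushout_isPushout φL (tL.comp φL), pushout_isPushout φR (tL.comp φL)⟩
    obtain ⟨b, hb⟩ := exists_left_inverse hcore
      ((r.comp h).comp (pushoutInr φR (tL.comp φL)))
    refine ⟨b.comp ((r.comp h).comp (pushoutInl φR (tL.comp φL))), ?_⟩
    have hc := (pushout_isPushout φR (tL.comp φL)).comm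
    calc tL.comp φL = (LGraph.Hom.idHom C).comp (tL.comp φL) := rfl
      _ = (b.comp (r.comp h)).comp ((pushoutInr φR (tL.comp φL)).comp (tL.comp φL)) := by
        rw [← hb]; rfl
      _ = _ := by rw [← hc]; rfl
  · rintro hex G H ⟨g⟩ ⟨D, m, n, m', c1, c2, p1, p2⟩
    obtain ⟨tR, hR⟩ := hex ((r.comp g).comp m)
    have w : tR.comp φR = ((r.comp g).comp c1).comp n := by
      rw [← hR, LGraph.Hom.comp_assoc', p1.comm]; rfl
    obtain ⟨u, -, -⟩ := p2.universal C tR _ w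
    exact ⟨i.comp u⟩
end

section
/- Let T[M] be a multiply annotated type graph over B^n. Then L(T[M]) = ∅ if and only if M = ∅ or for every pair (ℓ,u) ∈ M there exists an edge e ∈ E_T such that ℓ(e) ≥ 1 and (u(src(e)) = 0 or u(tgt(e)) = 0). -/
/-- An annotation of a graph `G` over `B^n`: a function from the items (nodes and
edges) of `G` to the ℓ-monoid `M_n = {0,1,…,n,m}`, where `m` is represented by `n+1`.
The order is the pointwise one. -/
abbrev Ann {Λ : Type} (n : ℕ) (G : LGraph Λ) : Type := (G.V ⊕ G.E) → Fin (n + 2)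

/-- The action of a graph morphism on items. -/
def LGraph.Hom.itemMap {Λ : Type} {G H : LGraph Λ} (φ : LGraph.Hom G H) :
    (G.V ⊕ G.E) → (H.V ⊕ H.E) := Sum.map φ.fV φ.fE

/-- Truncation into `M_n = {0,…,n,m}`: any value exceeding `n` becomes `m` (= `n+1`). -/
def truncate (n k : ℕ) : Fin (n + 2) := ⟨min k (n + 1), by omega⟩

/-- The pushforward annotation `B^n_φ(a)`: each item `y` of the target receives the
(truncated) sum of `a x` over all items `x` with `φ(x) = y`. -/
noncomputable def pushAnn {Λ : Type} {n : ℕ} {G H : LGraph Λ}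
    (φ : LGraph.Hom G H) (a : Ann n G) : Ann n H :=
  fun y => truncate n (∑ᶠ x ∈ {x | φ.itemMap x = y}, ((a x : ℕ)))

/-- The standard annotation `s_G`, mapping every node and edge of `G` to `1`. -/
def stdAnn {Λ : Type} (n : ℕ) (G : LGraph Λ) : Ann n G := fun _ => 1

/-- `φ : T1[M1] → T2[M2]` is a legal morphism if for every `(ℓ,u) ∈ M1` there is
`(ℓ',u') ∈ M2` with `ℓ' ≤ B^n_φ(ℓ)` and `B^n_φ(u) ≤ u'`. -/
def Legal {Λ : Type} {n : ℕ} {T1 T2 : LGraph Λ}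
    (M1 : Set (Ann n T1 × Ann n T1)) (M2 : Set (Ann n T2 × Ann n T2))
    (φ : LGraph.Hom T1 T2) : Prop :=
  ∀ p ∈ M1, ∃ q ∈ M2, q.1 ≤ pushAnn φ p.1 ∧ pushAnn φ p.2 ≤ q.2

/-- The language of the multiply annotated type graph `T[M]`: all graphs `G` such
that there is a morphism `φ : G → T` and a pair `(ℓ,u) ∈ M` with
`ℓ ≤ B^n_φ(s_G) ≤ u`. -/
def AnnLang {Λ : Type} {n : ℕ} (T : LGraph Λ) (M : Set (Ann n T × Ann n T)) :
    Set (LGraph Λ) :=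
  {G | ∃ φ : LGraph.Hom G T, ∃ p ∈ M,
      p.1 ≤ pushAnn φ (stdAnn n G) ∧ pushAnn φ (stdAnn n G) ≤ p.2}

theorem pushAnn_std_eq {Λ : Type} {n : ℕ} {G H : LGraph Λ} (φ : LGraph.Hom G H)
    (y : H.V ⊕ H.E) :
    pushAnn φ (stdAnn n G) y = truncate n (Set.ncard {x | φ.itemMap x = y}) := by
  have h : (∑ᶠ x ∈ {x | φ.itemMap x = y}, ((stdAnn n G x : ℕ)))
      = Set.ncard {x | φ.itemMap x = y} := by
    have := G.finV
    have := G.finE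
    rw [finsum_mem_eq_finite_toFinset_sum _ (Set.toFinite _)]
    rw [Set.ncard_eq_toFinset_card _ (Set.toFinite _)]
    simp [stdAnn]
  unfold pushAnn
  rw [h]

theorem pushAnn_std_ne_zero {Λ : Type} {n : ℕ} {G H : LGraph Λ} (φ : LGraph.Hom G H)
    (y : H.V ⊕ H.E) :
    pushAnn φ (stdAnn n G) y ≠ 0 ↔ ∃ x, φ.itemMap x = y := by
  have := G.finV
  have := G.finE
  change _ ↔ Set.Nonempty {x | φ.itemMap x = y}
  rw [pushAnn_std_eq, ← Set.ncard_pos (Set.toFinite _), Ne, Fin.ext_iff]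
  simp only [truncate, Fin.val_zero]
  omega

theorem truncate_val {n : ℕ} (k : Fin (n + 2)) : truncate n (k : ℕ) = k := by
  apply Fin.ext
  simp only [truncate]
  omega

/-- The witness graph: `u v` copies of each node and `l e` copies of each edge. -/
def witGraph {Λ : Type} {n : ℕ} (T : LGraph Λ) (l u : Ann n T)
    (hs : ∀ e, 1 ≤ l (Sum.inr e) →
      0 < (u (Sum.inl (T.src e)) : ℕ) ∧ 0 < (u (Sum.inl (T.tgt e)) : ℕ)) : LGraph Λ where
  V := Σ v : T.V, Fin (u (Sum.inl v) : ℕ)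
  E := Σ e : T.E, Fin (l (Sum.inr e) : ℕ)
  finV := by have := T.finV; infer_instance
  finE := by have := T.finE; infer_instance
  src e := ⟨T.src e.1, ⟨0, (hs e.1 (by
    rw [Fin.le_def, Fin.val_one]; have := e.2.2; omega)).1⟩⟩
  tgt e := ⟨T.tgt e.1, ⟨0, (hs e.1 (by
    rw [Fin.le_def, Fin.val_one]; have := e.2.2; omega)).2⟩⟩
  lab e := T.lab e.1

def witHom {Λ : Type} {n : ℕ} (T : LGraph Λ) (l u : Ann n T)
    (hs : ∀ e, 1 ≤ l (Sum.inr e) →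
      0 < (u (Sum.inl (T.src e)) : ℕ) ∧ 0 < (u (Sum.inl (T.tgt e)) : ℕ)) :
    LGraph.Hom (witGraph T l u hs) T where
  fV v := v.1
  fE e := e.1
  src_comm _ := rfl
  tgt_comm _ := rfl
  lab_comm _ := rfl

theorem witPush_inl {Λ : Type} {n : ℕ} (T : LGraph Λ) (l u : Ann n T)
    (hs : ∀ e, 1 ≤ l (Sum.inr e) →
      0 < (u (Sum.inl (T.src e)) : ℕ) ∧ 0 < (u (Sum.inl (T.tgt e)) : ℕ)) (v : T.V) :
    pushAnn (witHom T l u hs) (stdAnn n _) (Sum.inl v) = u (Sum.inl v) := by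
  rw [pushAnn_std_eq]
  have : {x | (witHom T l u hs).itemMap x = Sum.inl v} =
      (fun i : Fin (u (Sum.inl v) : ℕ) =>
        (Sum.inl ⟨v, i⟩ : (witGraph T l u hs).V ⊕ (witGraph T l u hs).E)) '' Set.univ := by
    ext x
    constructor
    · rcases x with ⟨w, i⟩ | e
      · intro h
        have h' : w = v := Sum.inl.inj h
        subst h'
        exact ⟨i, trivial, rfl⟩
      · intro h
        exact absurd h Sum.inr_ne_inl
    · rintro ⟨i, -, rfl⟩
      rfl
  rw [this, Set.ncard_image_of_injective, Set.ncard_univ, Nat.card_fin, truncate_val]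
  intro i j h
  exact eq_of_heq (Sigma.mk.inj (Sum.inl.inj h)).2

theorem witPush_inr {Λ : Type} {n : ℕ} (T : LGraph Λ) (l u : Ann n T)
    (hs : ∀ e, 1 ≤ l (Sum.inr e) →
      0 < (u (Sum.inl (T.src e)) : ℕ) ∧ 0 < (u (Sum.inl (T.tgt e)) : ℕ)) (v : T.E) :
    pushAnn (witHom T l u hs) (stdAnn n _) (Sum.inr v) = l (Sum.inr v) := by
  rw [pushAnn_std_eq]
  have : {x | (witHom T l u hs).itemMap x = Sum.inr v} =
      (fun i : Fin (l (Sum.inr v) : ℕ) =>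
        (Sum.inr ⟨v, i⟩ : (witGraph T l u hs).V ⊕ (witGraph T l u hs).E)) '' Set.univ := by
    ext x
    constructor
    · rcases x with e | ⟨w, i⟩
      · intro h
        exact absurd h Sum.inl_ne_inr
      · intro h
        have h' : w = v := Sum.inr.inj h
        subst h'
        exact ⟨i, trivial, rfl⟩
    · rintro ⟨i, -, rfl⟩
      rfl
  rw [this, Set.ncard_image_of_injective, Set.ncard_univ, Nat.card_fin, truncate_val]
  intro i j h
  exact eq_of_heq (Sigma.mk.inj (Sum.inr.inj h)).2

/-- Emptiness for annotated type graphs: `L(T[M]) = ∅` iff `M = ∅` or every pair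
`(ℓ,u) ∈ M` has an edge `e` with `ℓ(e) ≥ 1` and `u(src e) = 0` or `u(tgt e) = 0`. -/
theorem annLang_empty_iff {Λ : Type} {n : ℕ} (hn : 1 ≤ n) (T : LGraph Λ)
    (M : Set (Ann n T × Ann n T)) (hM : ∀ p ∈ M, p.1 ≤ p.2) :
    AnnLang T M = ∅ ↔
      (M = ∅ ∨ ∀ p ∈ M, ∃ e : T.E,
        1 ≤ p.1 (Sum.inr e) ∧
        (p.2 (Sum.inl (T.src e)) = 0 ∨ p.2 (Sum.inl (T.tgt e)) = 0)) := by
  constructor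
  · intro hE
    right
    intro p hp
    by_contra hcon
    have hs : ∀ e, 1 ≤ p.1 (Sum.inr e) →
        0 < (p.2 (Sum.inl (T.src e)) : ℕ) ∧ 0 < (p.2 (Sum.inl (T.tgt e)) : ℕ) := by
      intro e he
      constructor
      · refine Nat.pos_of_ne_zero fun h0 => hcon ⟨e, he, Or.inl (Fin.ext ?_)⟩
        simpa using h0
      · refine Nat.pos_of_ne_zero fun h0 => hcon ⟨e, he, Or.inr (Fin.ext ?_)⟩
        simpa using h0
    have hmem : witGraph T p.1 p.2 hs ∈ AnnLang T M := by
      refine ⟨witHom T p.1 p.2 hs, p, hp, ?_, ?_⟩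
      · rintro (v | e)
        · rw [witPush_inl]
          exact hM p hp _
        · rw [witPush_inr]
      · rintro (v | e)
        · rw [witPush_inl]
        · rw [witPush_inr]
          exact hM p hp _
    rw [hE] at hmem
    exact hmem
  · intro h
    rw [Set.eq_empty_iff_forall_notMem]
    rintro G ⟨φ, p, hp, hl, hu⟩
    rcases h with h | h
    · rw [h] at hp
      exact hp
    · obtain ⟨e, he, h0⟩ := h p hp
      have hne : pushAnn φ (stdAnn n G) (Sum.inr e) ≠ 0 := by
        intro hz
        have h1 := he.trans (hl (Sum.inr e))
        rw [hz, Fin.le_def, Fin.val_one] at h1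
        simp at h1
      rw [pushAnn_std_ne_zero] at hne
      obtain ⟨x | d, hx⟩ := hne
      · exact absurd hx Sum.inl_ne_inr
      · have hd : φ.fE d = e := Sum.inr.inj hx
        subst hd
        rcases h0 with h0 | h0
        · have := hu (Sum.inl (T.src (φ.fE d)))
          rw [h0] at this
          refine (pushAnn_std_ne_zero φ _).2 ⟨Sum.inl (G.src d), ?_⟩ (le_antisymm this (Fin.zero_le _))
          rw [φ.src_comm]
          rfl
        · have := hu (Sum.inl (T.tgt (φ.fE d)))
          rw [h0] at this
          refine (pushAnn_std_ne_zero φ _).2 ⟨Sum.inl (G.tgt d), ?_⟩ (le_antisymm this (Fin.zero_le _))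
          rw [φ.tgt_comm]
          rfl
end

section
/- Let T_1[M_1] and T_2[M_2] be multiply annotated type graphs over B^n. If there exists a legal morphism φ : T_1[M_1] → T_2[M_2], then L(T_1[M_1]) ⊆ L(T_2[M_2]). -/
open Classical in
theorem pushAnn_val {Λ : Type} {n : ℕ} {G H : LGraph Λ} [Fintype (G.V ⊕ G.E)]
    (φ : LGraph.Hom G H) (a : Ann n G) (y : H.V ⊕ H.E) :
    (pushAnn φ a y : ℕ) =
      min (∑ x ∈ Finset.univ.filter (fun x => φ.itemMap x = y), (a x : ℕ)) (n + 1) := by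
  have h : (∑ᶠ x ∈ {x | φ.itemMap x = y}, (a x : ℕ)) =
      ∑ x ∈ Finset.univ.filter (fun x => φ.itemMap x = y), (a x : ℕ) := by
    rw [← finsum_mem_coe_finset]
    simp
  simp only [pushAnn, truncate, h]

theorem LGraph.finite_items {Λ : Type} (G : LGraph Λ) : Finite (G.V ⊕ G.E) := by
  haveI := G.finV
  haveI := G.finE
  infer_instance

theorem pushAnn_mono {Λ : Type} {n : ℕ} {G H : LGraph Λ}
    (φ : LGraph.Hom G H) {a b : Ann n G} (h : a ≤ b) : pushAnn φ a ≤ pushAnn φ b := by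
  classical
  haveI := G.finite_items
  haveI := Fintype.ofFinite (G.V ⊕ G.E)
  intro y
  rw [Fin.le_def, pushAnn_val, pushAnn_val]
  exact min_le_min_right _ (Finset.sum_le_sum fun x _ => Fin.le_def.mp (h x))

theorem min_sum_min {ι : Type} (s : Finset ι) (f : ι → ℕ) (N : ℕ) :
    min (∑ i ∈ s, min (f i) N) N = min (∑ i ∈ s, f i) N := by
  classical
  induction s using Finset.induction_on with
  | empty => simp
  | insert a s ha ih =>
    rw [Finset.sum_insert ha, Finset.sum_insert ha]
    omega

theorem pushAnn_comp {Λ : Type} {n : ℕ} {G H K : LGraph Λ}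
    (ψ : LGraph.Hom H K) (φ : LGraph.Hom G H) (a : Ann n G) :
    pushAnn (ψ.comp φ) a = pushAnn ψ (pushAnn φ a) := by
  classical
  haveI := G.finite_items
  haveI := Fintype.ofFinite (G.V ⊕ G.E)
  haveI := H.finite_items
  haveI := Fintype.ofFinite (H.V ⊕ H.E)
  have hc : ∀ x, (ψ.comp φ).itemMap x = ψ.itemMap (φ.itemMap x) := by
    rintro (x | x) <;> rfl
  funext z
  apply Fin.ext
  rw [pushAnn_val, pushAnn_val]
  simp only [pushAnn_val, hc]
  rw [min_sum_min]
  congr 1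
  rw [← Finset.sum_fiberwise_of_maps_to
    (t := Finset.univ.filter (fun y => ψ.itemMap y = z)) (g := φ.itemMap)
    (by intro x hx; simpa using hx)]
  refine Finset.sum_congr rfl fun y hy => Finset.sum_congr ?_ fun _ _ => rfl
  ext x
  simp only [Finset.mem_filter, Finset.mem_univ, true_and] at hy ⊢
  constructor
  · exact fun h => h.2
  · rintro rfl
    exact ⟨hy, rfl⟩

/-- A legal morphism between multiply annotated type graphs implies language
inclusion: if `φ : T1[M1] → T2[M2]` is legal then `L(T1[M1]) ⊆ L(T2[M2])`. -/
theorem annLang_subset_of_legal {Λ : Type} {n : ℕ} (hn : 1 ≤ n)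
    {T1 T2 : LGraph Λ}
    (M1 : Set (Ann n T1 × Ann n T1)) (M2 : Set (Ann n T2 × Ann n T2))
    (hM1 : ∀ p ∈ M1, p.1 ≤ p.2) (hM2 : ∀ p ∈ M2, p.1 ≤ p.2)
    (φ : LGraph.Hom T1 T2) (hφ : Legal M1 M2 φ) :
    AnnLang T1 M1 ⊆ AnnLang T2 M2 := by
  rintro G ⟨ψ, p, hp, hl, hu⟩
  obtain ⟨q, hq, h1, h2⟩ := hφ p hp
  refine ⟨φ.comp ψ, q, hq, ?_, ?_⟩
  · rw [pushAnn_comp]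
    exact h1.trans (pushAnn_mono φ hl)
  · rw [pushAnn_comp]
    exact (pushAnn_mono φ hu).trans h2
end

section
/- Over B^1 (so M_1 = {0,1,m}), let T_1 be the graph with a single node v and no edges, annotated with M_1 = {(ℓ,u)} where ℓ(v) = 1 and u(v) = m; and let T_2 be the graph with two nodes v_1, v_2 and no edges, annotated with M_2 = {(ℓ',u')} where ℓ'(v_1) = 1, u'(v_1) = 1, ℓ'(v_2) = 0, u'(v_2) = m. Then L(T_1[M_1]) = L(T_2[M_2]) (both languages consist exactly of the nonempty discrete graphs), yet there exists no legal morphism T_1[M_1] → T_2[M_2]. Hence the existence of a legal morphism is sufficient but not necessary for language inclusion of annotated type graphs. -/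
/-- The discrete graph with a single node. -/
def oneNode (Λ : Type) : LGraph Λ where
  V := Unit
  E := Empty
  finV := inferInstance
  finE := inferInstance
  src e := e.elim
  tgt e := e.elim
  lab e := e.elim

/-- The discrete graph with two nodes. -/
def twoNode (Λ : Type) : LGraph Λ where
  V := Fin 2
  E := Empty
  finV := inferInstance
  finE := inferInstance
  src e := e.elim
  tgt e := e.elim
  lab e := e.elim

/-- `M_1 = {(ℓ,u)}` over `B^1` for `T_1`: `ℓ(v) = 1`, `u(v) = m` (= `2` in `Fin 3`). -/
def oneNodeAnn (Λ : Type) : Set (Ann 1 (oneNode Λ) × Ann 1 (oneNode Λ)) :=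
  {((fun _ => 1), (fun _ => 2))}

/-- `M_2 = {(ℓ',u')}` over `B^1` for `T_2`: `ℓ'(v₁) = 1`, `u'(v₁) = 1`,
`ℓ'(v₂) = 0`, `u'(v₂) = m` (= `2` in `Fin 3`). -/
def twoNodeAnn (Λ : Type) : Set (Ann 1 (twoNode Λ) × Ann 1 (twoNode Λ)) :=
  {((Sum.elim ![1, 0] (fun e => e.elim)), (Sum.elim ![1, 2] (fun e => e.elim)))}

theorem pushAnn_pos {Λ : Type} {n : ℕ} {G H : LGraph Λ} (φ : LGraph.Hom G H) (a : Ann n G)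
    (x : G.V ⊕ G.E) (hx : 1 ≤ (a x : ℕ)) : 1 ≤ (pushAnn φ a (φ.itemMap x) : ℕ) := by
  have := G.finV
  have := G.finE
  have h : 0 < ∑ᶠ z ∈ {z | φ.itemMap z = φ.itemMap x}, ((a z : ℕ)) := by
    rw [finsum_mem_eq_finite_toFinset_sum _ (Set.toFinite _)]
    exact Finset.sum_pos' (fun _ _ => Nat.zero_le _) ⟨x, by simp, hx⟩
  simp only [pushAnn, truncate]
  omega

theorem exists_of_pushAnn_pos {Λ : Type} {n : ℕ} {G H : LGraph Λ} (φ : LGraph.Hom G H)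
    (a : Ann n G) (y : H.V ⊕ H.E) (hy : 1 ≤ (pushAnn φ a y : ℕ)) : ∃ x, φ.itemMap x = y := by
  by_contra hc
  push Not at hc
  have : {x | φ.itemMap x = y} = ∅ := by
    ext x; simpa using hc x
  simp [pushAnn, truncate, this] at hy

theorem pushAnn_unique {Λ : Type} {n : ℕ} {G H : LGraph Λ} (φ : LGraph.Hom G H)
    (a : Ann n G) (y : H.V ⊕ H.E) (x : G.V ⊕ G.E) (hx : ∀ z, φ.itemMap z = y ↔ z = x) :
    (pushAnn φ a y : ℕ) = a x := by
  have : {z | φ.itemMap z = y} = {x} := by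
    ext z; simpa using hx z
  simp only [pushAnn, truncate, this, finsum_mem_singleton]
  have := (a x).isLt
  omega

theorem annLang_one {Λ : Type} : AnnLang (oneNode Λ) (oneNodeAnn Λ) =
      {G : LGraph Λ | Nonempty G.V ∧ IsEmpty G.E} := by
  ext G
  constructor
  · rintro ⟨φ, p, hp, h1, -⟩
    obtain rfl := hp
    have hE : IsEmpty G.E := ⟨fun e => Empty.elim (φ.fE e)⟩
    refine ⟨?_, hE⟩
    obtain ⟨x, -⟩ := exists_of_pushAnn_pos φ _ (Sum.inl ()) (h1 (Sum.inl ()))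
    rcases x with v | e
    · exact ⟨v⟩
    · exact hE.elim e
  · rintro ⟨⟨v⟩, hE⟩
    refine ⟨⟨fun _ => (), fun e => hE.elim e, fun e => hE.elim e, fun e => hE.elim e,
      fun e => hE.elim e⟩, _, rfl, ?_, ?_⟩
    · rintro (y | y)
      · exact pushAnn_pos _ (stdAnn 1 G) (Sum.inl v) le_rfl
      · exact Empty.elim y
    · intro y
      exact Fin.le_last _

theorem annLang_two {Λ : Type} : AnnLang (twoNode Λ) (twoNodeAnn Λ) =
      {G : LGraph Λ | Nonempty G.V ∧ IsEmpty G.E} := by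
  classical
  ext G
  constructor
  · rintro ⟨φ, p, hp, h1, -⟩
    obtain rfl := hp
    have hE : IsEmpty G.E := ⟨fun e => Empty.elim (φ.fE e)⟩
    refine ⟨?_, hE⟩
    obtain ⟨x, -⟩ := exists_of_pushAnn_pos φ _ (Sum.inl (0 : Fin 2)) (h1 (Sum.inl (0 : Fin 2)))
    rcases x with v | e
    · exact ⟨v⟩
    · exact hE.elim e
  · rintro ⟨⟨v⟩, hE⟩
    let φ : LGraph.Hom G (twoNode Λ) :=
      ⟨fun w => if w = v then (0 : Fin 2) else (1 : Fin 2), fun e => hE.elim e,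
        fun e => hE.elim e, fun e => hE.elim e, fun e => hE.elim e⟩
    have key : (pushAnn φ (stdAnn 1 G) (Sum.inl (0 : Fin 2)) : ℕ) = 1 := by
      refine pushAnn_unique φ (stdAnn 1 G) (Sum.inl (0 : Fin 2)) (Sum.inl v) ?_
      rintro (w | e)
      · by_cases h : w = v
        · simp [LGraph.Hom.itemMap, φ, h]
        · have h10 : (1 : Fin 2) ≠ 0 := by decide
          have hv : φ.fV w = (1 : Fin 2) := if_neg h
          constructor
          · intro hc
            exact absurd (hv.symm.trans (Sum.inl.inj hc)) h10
          · intro hc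
            exact absurd (Sum.inl.inj hc) h
      · exact hE.elim e
    refine ⟨φ, _, rfl, ?_, ?_⟩
    · rintro (y | y)
      · change Fin 2 at y
        fin_cases y
        · exact key.ge
        · exact Fin.zero_le _
      · exact Empty.elim y
    · rintro (y | y)
      · change Fin 2 at y
        fin_cases y
        · exact key.le
        · exact Fin.le_last _
      · exact Empty.elim y

/-- The two annotated type graphs have the same language — exactly the nonempty
discrete graphs — but there exists no legal morphism `T_1[M_1] → T_2[M_2]`.
Hence legal morphisms are sufficient but not necessary for language inclusion. -/
theorem legal_not_necessary_for_inclusion {Λ : Type} :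
    AnnLang (oneNode Λ) (oneNodeAnn Λ) = AnnLang (twoNode Λ) (twoNodeAnn Λ) ∧
    AnnLang (oneNode Λ) (oneNodeAnn Λ) =
      {G : LGraph Λ | Nonempty G.V ∧ IsEmpty G.E} ∧
    ¬ ∃ φ : LGraph.Hom (oneNode Λ) (twoNode Λ), Legal (oneNodeAnn Λ) (twoNodeAnn Λ) φ := by
  refine ⟨annLang_one.trans annLang_two.symm, annLang_one, ?_⟩
  rintro ⟨φ, hφ⟩
  obtain ⟨q, hq, h1, h2⟩ := hφ _ rfl
  obtain rfl := hq
  obtain ⟨x, hx⟩ := exists_of_pushAnn_pos φ _ (Sum.inl (0 : Fin 2)) (h1 (Sum.inl (0 : Fin 2)))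
  have hu : ∀ z, φ.itemMap z = Sum.inl (0 : Fin 2) ↔ z = x := by
    intro z
    have : z = x := by
      rcases z with z | z
      · rcases x with x | x
        · rfl
        · exact Empty.elim x
      · exact Empty.elim z
    subst this
    exact ⟨fun _ => rfl, fun _ => hx⟩
  have h3 := pushAnn_unique (n := 1) φ (fun _ => 2) _ x hu
  have h4 : (pushAnn (n := 1) φ (fun _ => 2) (Sum.inl (0 : Fin 2)) : ℕ) ≤ 1 := h2 (Sum.inl (0 : Fin 2))
  have h6 : (2 : ℕ) ≤ 1 := h3.symm.le.trans h4
  omega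
end

section
/- Let T_1[M_1] and T_2[M_2] be multiply annotated type graphs over B^n, let T_1 ⊕ T_2 be the coproduct (disjoint union) graph with injections i_1 : T_1 → T_1 ⊕ T_2 and i_2 : T_2 → T_1 ⊕ T_2, and let N = { (B^n_{i_1}(ℓ), B^n_{i_1}(u)) | (ℓ,u) ∈ M_1 } ∪ { (B^n_{i_2}(ℓ), B^n_{i_2}(u)) | (ℓ,u) ∈ M_2 }. Then L((T_1 ⊕ T_2)[N]) = L(T_1[M_1]) ∪ L(T_2[M_2]); i.e., languages of multiply annotated type graphs over B^n are closed under union. -/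
/-- The coproduct (disjoint union) graph `T1 ⊕ T2`. -/
def coprodGraph {Λ : Type} (T1 T2 : LGraph Λ) : LGraph Λ where
  V := T1.V ⊕ T2.V
  E := T1.E ⊕ T2.E
  finV := by have := T1.finV; have := T2.finV; exact inferInstance
  finE := by have := T1.finE; have := T2.finE; exact inferInstance
  src := Sum.map T1.src T2.src
  tgt := Sum.map T1.tgt T2.tgt
  lab := Sum.elim T1.lab T2.lab

/-- The first injection `i₁ : T1 → T1 ⊕ T2`. -/
def coprodInj1 {Λ : Type} (T1 T2 : LGraph Λ) : LGraph.Hom T1 (coprodGraph T1 T2) where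
  fV := Sum.inl
  fE := Sum.inl
  src_comm _ := rfl
  tgt_comm _ := rfl
  lab_comm _ := rfl

/-- The second injection `i₂ : T2 → T1 ⊕ T2`. -/
def coprodInj2 {Λ : Type} (T1 T2 : LGraph Λ) : LGraph.Hom T2 (coprodGraph T1 T2) where
  fV := Sum.inr
  fE := Sum.inr
  src_comm _ := rfl
  tgt_comm _ := rfl
  lab_comm _ := rfl

theorem pushAnn_pos_aux {Λ : Type} {n : ℕ} {G H : LGraph Λ} (ψ : LGraph.Hom G H)
    (x : G.V ⊕ G.E) : pushAnn ψ (stdAnn n G) (ψ.itemMap x) ≠ 0 := by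
  classical
  haveI := G.finV
  haveI := G.finE
  intro h
  have h1 := congrArg Fin.val h
  simp only [pushAnn, truncate, Fin.val_zero] at h1
  have h2 : (0:ℕ) < ∑ᶠ z ∈ {z | ψ.itemMap z = ψ.itemMap x}, ((stdAnn n G z : Fin (n+2)) : ℕ) := by
    rw [finsum_mem_eq_finite_toFinset_sum _ (Set.toFinite _)]
    apply Finset.sum_pos
    · intro i _
      simp [stdAnn]
    · exact ⟨x, by simp⟩
  omega

theorem pushAnn_inj_apply {Λ : Type} {n : ℕ} {T T' : LGraph Λ} (ι : LGraph.Hom T T')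
    (hι : Function.Injective ι.itemMap) (a : Ann n T) (x : T.V ⊕ T.E) :
    pushAnn ι a (ι.itemMap x) = a x := by
  have : {z | ι.itemMap z = ι.itemMap x} = {x} := by
    ext z; exact hι.eq_iff
  apply Fin.ext
  have h3 := (a x).isLt
  simp only [pushAnn, truncate, this, finsum_mem_singleton]
  omega

theorem pushAnn_not_range {Λ : Type} {n : ℕ} {T T' : LGraph Λ} (ι : LGraph.Hom T T')
    (a : Ann n T) (y : T'.V ⊕ T'.E) (hy : ∀ x, ι.itemMap x ≠ y) :
    pushAnn ι a y = 0 := by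
  have : {z | ι.itemMap z = y} = ∅ := by
    ext z; simp [hy]
  apply Fin.ext
  simp [pushAnn, truncate, this]

theorem itemMap_comp_aux {Λ : Type} {G T T' : LGraph Λ} (ι : LGraph.Hom T T')
    (φ : LGraph.Hom G T) (x : G.V ⊕ G.E) :
    (ι.comp φ).itemMap x = ι.itemMap (φ.itemMap x) := by
  cases x <;> rfl

theorem pushAnn_comp_eq {Λ : Type} {n : ℕ} {G T T' : LGraph Λ} (ι : LGraph.Hom T T')
    (hι : Function.Injective ι.itemMap) (φ : LGraph.Hom G T) (a : Ann n G) :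
    pushAnn (ι.comp φ) a = pushAnn ι (pushAnn φ a) := by
  funext y
  by_cases hy : ∃ x, ι.itemMap x = y
  · obtain ⟨x, rfl⟩ := hy
    rw [pushAnn_inj_apply ι hι]
    simp only [pushAnn, itemMap_comp_aux, hι.eq_iff]
  · push Not at hy
    rw [pushAnn_not_range ι _ y hy, pushAnn_not_range]
    intro x
    rw [itemMap_comp_aux]
    exact hy _

theorem pushAnn_le_iff {Λ : Type} {n : ℕ} {T T' : LGraph Λ} (ι : LGraph.Hom T T')
    (hι : Function.Injective ι.itemMap) (a b : Ann n T) :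
    pushAnn ι a ≤ pushAnn ι b ↔ a ≤ b := by
  constructor
  · intro h x
    have := h (ι.itemMap x)
    rwa [pushAnn_inj_apply ι hι, pushAnn_inj_apply ι hι] at this
  · intro h y
    by_cases hy : ∃ x, ι.itemMap x = y
    · obtain ⟨x, rfl⟩ := hy
      rw [pushAnn_inj_apply ι hι, pushAnn_inj_apply ι hι]
      exact h x
    · push Not at hy
      rw [pushAnn_not_range ι _ y hy, pushAnn_not_range ι _ y hy]

theorem exists_factor_aux {Λ : Type} {n : ℕ} {G T T' : LGraph Λ} (ι : LGraph.Hom T T')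
    (hι : Function.Injective ι.itemMap) (ψ : LGraph.Hom G T') (u : Ann n T)
    (h : pushAnn ψ (stdAnn n G) ≤ pushAnn ι u) : ∃ φ : LGraph.Hom G T, ψ = ι.comp φ := by
  have key : ∀ x, ∃ z, ι.itemMap z = ψ.itemMap x := by
    intro x
    by_contra hc
    push Not at hc
    have h1 := h (ψ.itemMap x)
    rw [pushAnn_not_range ι u _ hc] at h1
    exact pushAnn_pos_aux ψ x (le_antisymm h1 (Fin.zero_le _))
  have hV : ∀ v, ∃ w, ι.fV w = ψ.fV v := by
    intro v
    obtain ⟨z | z, hz⟩ := key (Sum.inl v)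
    · exact ⟨z, Sum.inl.inj hz⟩
    · cases hz
  have hE : ∀ v, ∃ w, ι.fE w = ψ.fE v := by
    intro v
    obtain ⟨z | z, hz⟩ := key (Sum.inr v)
    · cases hz
    · exact ⟨z, Sum.inr.inj hz⟩
  choose f hf using hV
  choose g hg using hE
  have hi : Function.Injective ι.fV := fun a b hab =>
    Sum.inl.inj (hι (show ι.itemMap (Sum.inl a) = ι.itemMap (Sum.inl b) from congrArg Sum.inl hab))
  refine ⟨⟨f, g, ?_, ?_, ?_⟩, ?_⟩
  · intro e
    apply hi
    rw [← ι.src_comm, hg, hf, ψ.src_comm]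
  · intro e
    apply hi
    rw [← ι.tgt_comm, hg, hf, ψ.tgt_comm]
  · intro e
    rw [← ι.lab_comm, hg, ψ.lab_comm]
  · cases ψ
    simp only [LGraph.Hom.comp, LGraph.Hom.mk.injEq]
    exact ⟨funext fun v => (hf v).symm, funext fun e => (hg e).symm⟩

theorem annLang_image_aux {Λ : Type} {n : ℕ} {T T' : LGraph Λ} (ι : LGraph.Hom T T')
    (hι : Function.Injective ι.itemMap) (M : Set (Ann n T × Ann n T)) :
    AnnLang T' ((fun p => (pushAnn ι p.1, pushAnn ι p.2)) '' M) = AnnLang T M := by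
  ext G
  constructor
  · rintro ⟨ψ, _, ⟨p, hp, rfl⟩, h1, h2⟩
    obtain ⟨φ, rfl⟩ := exists_factor_aux ι hι ψ p.2 h2
    rw [pushAnn_comp_eq ι hι] at h1 h2
    exact ⟨φ, p, hp, (pushAnn_le_iff ι hι _ _).1 h1, (pushAnn_le_iff ι hι _ _).1 h2⟩
  · rintro ⟨φ, p, hp, h1, h2⟩
    refine ⟨ι.comp φ, _, ⟨p, hp, rfl⟩, ?_, ?_⟩
    · rw [pushAnn_comp_eq ι hι]
      exact (pushAnn_le_iff ι hι _ _).2 h1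
    · rw [pushAnn_comp_eq ι hι]
      exact (pushAnn_le_iff ι hι _ _).2 h2

theorem annLang_union_sets {Λ : Type} {n : ℕ} (T : LGraph Λ) (A B : Set (Ann n T × Ann n T)) :
    AnnLang T (A ∪ B) = AnnLang T A ∪ AnnLang T B := by
  ext G
  constructor
  · rintro ⟨φ, p, hp | hp, h⟩
    · exact Or.inl ⟨φ, p, hp, h⟩
    · exact Or.inr ⟨φ, p, hp, h⟩
  · rintro (⟨φ, p, hp, h⟩ | ⟨φ, p, hp, h⟩)
    · exact ⟨φ, p, Or.inl hp, h⟩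
    · exact ⟨φ, p, Or.inr hp, h⟩

/-- Union of languages of multiply annotated type graphs over `B^n`: with
`N = B^n_{i₁}(M1) ∪ B^n_{i₂}(M2)` on the coproduct graph,
`L((T1 ⊕ T2)[N]) = L(T1[M1]) ∪ L(T2[M2])`. -/
theorem annLang_union {Λ : Type} {n : ℕ} (hn : 1 ≤ n) (T1 T2 : LGraph Λ)
    (M1 : Set (Ann n T1 × Ann n T1)) (M2 : Set (Ann n T2 × Ann n T2))
    (hM1 : ∀ p ∈ M1, p.1 ≤ p.2) (hM2 : ∀ p ∈ M2, p.1 ≤ p.2) :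
    AnnLang (coprodGraph T1 T2)
      (((fun p => (pushAnn (coprodInj1 T1 T2) p.1, pushAnn (coprodInj1 T1 T2) p.2)) '' M1) ∪
       ((fun p => (pushAnn (coprodInj2 T1 T2) p.1, pushAnn (coprodInj2 T1 T2) p.2)) '' M2)) =
      AnnLang T1 M1 ∪ AnnLang T2 M2 := by
  rw [annLang_union_sets, annLang_image_aux _ ?_ M1, annLang_image_aux _ ?_ M2]
  · exact Sum.map_injective.2 ⟨Sum.inr_injective, Sum.inr_injective⟩
  · exact Sum.map_injective.2 ⟨Sum.inl_injective, Sum.inl_injective⟩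
end

section
/- Working with annotations over B^n: let i : A → T be an injective graph morphism, let φ : G → T be a graph morphism, and let u be an annotation of A over B^n. If B^n_φ(s_G) ≤ B^n_i(u) (pointwise on the items of T), then there exists a graph morphism ζ : G → A with i ∘ ζ = φ. -/
theorem itemMap_mem_range {Λ : Type} {n : ℕ} {A T G : LGraph Λ} (i : LGraph.Hom A T)
    (φ : LGraph.Hom G T) (u : Ann n A)
    (h : pushAnn φ (stdAnn n G) ≤ pushAnn i u) (x : G.V ⊕ G.E) :
    ∃ a, i.itemMap a = φ.itemMap x := by
  by_contra hne
  push Not at hne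
  have hx := h (φ.itemMap x)
  have := G.finV
  have := G.finE
  have h2 : (∑ᶠ a ∈ {a | i.itemMap a = φ.itemMap x}, ((u a : ℕ))) = 0 := by
    have : {a | i.itemMap a = φ.itemMap x} = ∅ := by
      ext a
      simp [hne a]
    rw [this]
    simp
  have h1 : (∑ᶠ a ∈ {a | φ.itemMap a = φ.itemMap x}, ((stdAnn n G a : Fin (n + 2)) : ℕ)) ≠ 0 := by
    intro h0
    rw [finsum_mem_eq_finite_toFinset_sum _ (Set.toFinite _), Finset.sum_eq_zero_iff] at h0
    have := h0 x (by simp)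
    simp [stdAnn] at this
  simp only [pushAnn, h2, truncate, Fin.le_def] at hx
  omega

/-- If `i : A → T` is injective, `φ : G → T`, and `B^n_φ(s_G) ≤ B^n_i(u)` for some
annotation `u` of `A`, then `φ` factors through `i`: there is `ζ : G → A` with
`i ∘ ζ = φ`. -/
theorem factor_through_injective {Λ : Type} {n : ℕ} (hn : 1 ≤ n)
    {A T G : LGraph Λ} (i : LGraph.Hom A T)
    (hiV : Function.Injective i.fV) (hiE : Function.Injective i.fE)
    (φ : LGraph.Hom G T) (u : Ann n A)
    (h : pushAnn φ (stdAnn n G) ≤ pushAnn i u) :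
    ∃ ζ : LGraph.Hom G A, i.comp ζ = φ := by
  have hV : ∀ v, ∃ a, i.fV a = φ.fV v := by
    intro v
    obtain ⟨a | a, ha⟩ := itemMap_mem_range i φ u h (Sum.inl v)
    · exact ⟨a, by simpa [LGraph.Hom.itemMap] using ha⟩
    · simp [LGraph.Hom.itemMap] at ha
  have hE : ∀ e, ∃ a, i.fE a = φ.fE e := by
    intro e
    obtain ⟨a | a, ha⟩ := itemMap_mem_range i φ u h (Sum.inr e)
    · simp [LGraph.Hom.itemMap] at ha
    · exact ⟨a, by simpa [LGraph.Hom.itemMap] using ha⟩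
  choose fV hfV using hV
  choose fE hfE using hE
  refine ⟨⟨fV, fE, fun e => hiV ?_, fun e => hiV ?_, fun e => ?_⟩, ?_⟩
  · rw [← i.src_comm, hfE, hfV, φ.src_comm]
  · rw [← i.tgt_comm, hfE, hfV, φ.tgt_comm]
  · rw [← i.lab_comm, hfE, φ.lab_comm]
  · cases φ
    simp only [LGraph.Hom.comp, LGraph.Hom.mk.injEq]
    exact ⟨funext hfV, funext hfE⟩
end
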